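/- Let f = p_{1,0,−1} + p_{0,0,−1}. Then for every n ≥ 1: (i) f(d_{ι,(0,1,…,n−1,n+2)}) = −(n+2)²·d_{ι,(0,1,…,n−1,n+1)}; (ii) f(d_{ι,(0,1,…,n−1,n+1)}) = −(n+1)²·d_0; (iii) f(d_{ι,(0,1,…,n−2,n,n+1)}) = −n²·d_{ι,(0,1,…,n−1,n+1)}. -/

import Mathlib

open MvPolynomial

noncomputable section

/-- The polynomial ring `R = ℂ[Q_{a,b} : a,b ∈ ℕ]`. -/
abbrev RR : Type := MvPolynomial (ℕ × ℕ) ℂ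

/-- The coefficient `λ(a,b,w,l) = (−1)^{b+1}·(b+l)!/(l+w−a)!` if `l+w−a ≥ 0`, else `0`. -/
def lamC (a b : ℕ) (w : ℤ) (l : ℕ) : ℂ :=
  if 0 ≤ (l : ℤ) + w - a then
    (-1) ^ (b + 1) * (Nat.factorial (b + l) : ℂ) /
      (Nat.factorial ((l : ℤ) + w - a).toNat : ℂ)
  else 0

/-- The coefficient `μ(a,b,w,m) = (−1)^a·(a+m)!/(m+w−b)!` if `m+w−b ≥ 0`, else `0`. -/
def muC (a b : ℕ) (w : ℤ) (m : ℕ) : ℂ :=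
  if 0 ≤ (m : ℤ) + w - b then
    (-1) ^ a * (Nat.factorial (a + m) : ℂ) /
      (Nat.factorial ((m : ℤ) + w - b).toNat : ℂ)
  else 0

/-- The derivation `p_{a,b,w}` of `R` with
`p_{a,b,w}(Q_{l,m}) = λ(a,b,w,l)·Q_{l+w,m} + μ(a,b,w,m)·Q_{l,m+w}`, where a summand is
interpreted as `0` whenever its coefficient is `0` (a nonzero coefficient forces the
corresponding shifted index to be a nonnegative integer). -/
def pDer (a b : ℕ) (w : ℤ) : Derivation ℂ RR RR :=
  MvPolynomial.mkDerivation ℂ fun lm : ℕ × ℕ =>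
    lamC a b w lm.1 • X (((lm.1 : ℤ) + w).toNat, lm.2) +
      muC a b w lm.2 • X (lm.1, ((lm.2 : ℤ) + w).toNat)

/-- The determinant `d_{I,J}` of the `(n+1)×(n+1)` matrix with `(r,s)` entry `Q_{i_r,j_s}`. -/
def dDet (n : ℕ) (I J : Fin (n + 1) → ℕ) : RR :=
  Matrix.det (Matrix.of fun r s => (X (I r, J s) : RR))

/-- The tuple `ι = (0,1,…,n)`. -/
def iot (n : ℕ) : Fin (n + 1) → ℕ := fun r => (r : ℕ)

theorem der_prod {ι : Type*} [DecidableEq ι] (D : Derivation ℂ RR RR) (s : Finset ι) (g : ι → RR) :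
    D (∏ i ∈ s, g i) = ∑ i ∈ s, ∏ j ∈ s, if j = i then D (g j) else g j := by
  induction s using Finset.induction_on with
  | empty => simp
  | insert a s ha ih =>
    rw [Finset.prod_insert ha, D.leibniz, ih, Finset.sum_insert ha, Finset.prod_insert ha]
    simp only [smul_eq_mul, if_true]
    rw [add_comm, Finset.mul_sum]
    congr 1
    · rw [mul_comm]
      congr 1
      refine Finset.prod_congr rfl fun j hj => ?_
      rw [if_neg (fun h : j = a => ha (h ▸ hj))]
    · refine Finset.sum_congr rfl fun i hi => ?_
      rw [Finset.prod_insert ha, if_neg (fun h : a = i => ha (h ▸ hi))]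

theorem der_det {ι : Type*} [DecidableEq ι] [Fintype ι] (D : Derivation ℂ RR RR)
    (M : Matrix ι ι RR) :
    D M.det = ∑ s, (M.updateCol s fun r => D (M r s)).det := by
  simp only [Matrix.det_apply]
  rw [map_sum, Finset.sum_comm]
  refine Finset.sum_congr rfl fun σ _ => ?_
  rw [← Finset.smul_sum]
  rw [Units.smul_def, map_zsmul, der_prod, Units.smul_def]
  congr 1
  refine Finset.sum_congr rfl fun i _ => Finset.prod_congr rfl fun j _ => ?_
  by_cases h : j = i
  · subst h; simp
  · simp [Matrix.updateCol_apply, h]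

/-- row part -/
def derA : Derivation ℂ RR RR :=
  MvPolynomial.mkDerivation ℂ fun lm : ℕ × ℕ => (-(lm.1 : ℂ) ^ 2) • X (lm.1 - 1, lm.2)

/-- column part -/
def derB : Derivation ℂ RR RR :=
  MvPolynomial.mkDerivation ℂ fun lm : ℕ × ℕ => (-(lm.2 : ℂ) ^ 2) • X (lm.1, lm.2 - 1)

theorem lam_sum (l : ℕ) : lamC 1 0 (-1) l + lamC 0 0 (-1) l = -(l : ℂ) ^ 2 := by
  rcases l with _ | _ | l
  · simp [lamC]
  · simp [lamC]
  · have h1 : (((l + 1 + 1 : ℕ) : ℤ) + -1 - (1 : ℕ)) = (l : ℤ) := by push_cast; ring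
    have h2 : (((l + 1 + 1 : ℕ) : ℤ) + -1 - (0 : ℕ)) = ((l + 1 : ℕ) : ℤ) := by push_cast; ring
    have := Nat.cast_ne_zero (R := ℂ) |>.2 (Nat.factorial_ne_zero l)
    have h3 : (l : ℂ) + 1 ≠ 0 := by exact_mod_cast Nat.succ_ne_zero l
    unfold lamC
    rw [h1, h2, if_pos (by positivity), if_pos (by positivity), Int.toNat_natCast,
      Int.toNat_natCast]
    simp only [zero_add, Nat.factorial_succ]
    push_cast
    field_simp
    ring

theorem mu_sum (m : ℕ) : muC 1 0 (-1) m + muC 0 0 (-1) m = -(m : ℂ) ^ 2 := by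
  rcases m with _ | l
  · simp [muC]
  · have h2 : (((l + 1 : ℕ) : ℤ) + -1 - (0 : ℕ)) = ((l : ℕ) : ℤ) := by push_cast; ring
    have := Nat.cast_ne_zero (R := ℂ) |>.2 (Nat.factorial_ne_zero l)
    unfold muC
    rw [h2, if_pos (by positivity), if_pos (by positivity), Int.toNat_natCast]
    simp only [zero_add, add_comm 1, Nat.factorial_succ]
    push_cast
    field_simp
    ring

theorem f_eq : pDer 1 0 (-1) + pDer 0 0 (-1) = derA + derB := by
  apply MvPolynomial.derivation_ext
  rintro ⟨l, m⟩
  have h (k : ℕ) : ((k : ℤ) + -1).toNat = k - 1 := by omega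
  simp only [Derivation.add_apply, pDer, derA, derB, mkDerivation_X, h]
  rw [← lam_sum l, ← mu_sum m, add_smul, add_smul]
  abel

theorem derB_det (n : ℕ) (I J : Fin (n + 1) → ℕ) :
    derB (dDet n I J) =
      ∑ s, (-(J s : ℂ) ^ 2) • dDet n I (Function.update J s (J s - 1)) := by
  rw [dDet, der_det]
  refine Finset.sum_congr rfl fun s _ => ?_
  have h1 : (fun r => derB ((Matrix.of fun r s => (X (I r, J s) : RR)) r s)) =
      (C (-(J s : ℂ) ^ 2) : RR) • (fun r => (X (I r, J s - 1) : RR)) := by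
    funext r
    simp [derB, mkDerivation_X, MvPolynomial.smul_eq_C_mul]
  rw [h1, Matrix.det_updateCol_smul, MvPolynomial.smul_eq_C_mul, dDet]
  congr 2
  ext1 r t
  by_cases h : t = s
  · subst h; simp
  · simp [Matrix.updateCol_apply, h]

theorem derA_det (n : ℕ) (I J : Fin (n + 1) → ℕ) :
    derA (dDet n I J) =
      ∑ s, (-(I s : ℂ) ^ 2) • dDet n (Function.update I s (I s - 1)) J := by
  rw [dDet, ← Matrix.det_transpose, der_det]
  refine Finset.sum_congr rfl fun s _ => ?_
  have h1 : (fun r => derA ((Matrix.of fun r s => (X (I r, J s) : RR)).transpose r s)) =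
      (C (-(I s : ℂ) ^ 2) : RR) • (fun r => (X (I s - 1, J r) : RR)) := by
    funext r
    simp [derA, mkDerivation_X, MvPolynomial.smul_eq_C_mul]
  rw [h1, Matrix.det_updateCol_smul, MvPolynomial.smul_eq_C_mul, dDet, ← Matrix.det_transpose]
  congr 2
  ext1 r t
  by_cases h : r = s
  · subst h; simp [Matrix.transpose_apply]
  · simp [Matrix.updateCol_apply, h]

theorem dDet_zero_row (n : ℕ) (I J : Fin (n + 1) → ℕ) (a b : Fin (n + 1)) (hab : a ≠ b)
    (h : I a = I b) : dDet n I J = 0 :=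
  Matrix.det_zero_of_row_eq hab (by funext s; simp [h])

theorem dDet_zero_col (n : ℕ) (I J : Fin (n + 1) → ℕ) (a b : Fin (n + 1)) (hab : a ≠ b)
    (h : J a = J b) : dDet n I J = 0 :=
  Matrix.det_zero_of_column_eq hab (by intro s; simp [h])

theorem derA_iot (n : ℕ) (J : Fin (n + 1) → ℕ) : derA (dDet n (iot n) J) = 0 := by
  rw [derA_det]
  refine Finset.sum_eq_zero fun s _ => ?_
  by_cases h : (s : ℕ) = 0
  · simp [iot, h]
  · have hlt : (s : ℕ) - 1 < n + 1 := by omega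
    have hne : (⟨(s : ℕ) - 1, hlt⟩ : Fin (n + 1)) ≠ s := by
      intro e; have := congrArg Fin.val e; simp at this; omega
    rw [dDet_zero_row n _ J ⟨(s : ℕ) - 1, hlt⟩ s hne, smul_zero]
    rw [Function.update_of_ne hne, Function.update_self]
    rfl

/-- all columns but one contribute zero -/
theorem f_single (n : ℕ) (J : Fin (n + 1) → ℕ) (t : Fin (n + 1))
    (h : ∀ s, s ≠ t → J s = 0 ∨ ∃ u, u ≠ s ∧ J u = J s - 1) :
    (pDer 1 0 (-1) + pDer 0 0 (-1)) (dDet n (iot n) J) =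
      (-(J t : ℂ) ^ 2) • dDet n (iot n) (Function.update J t (J t - 1)) := by
  rw [f_eq, Derivation.add_apply, derA_iot, zero_add, derB_det]
  refine Finset.sum_eq_single t (fun s _ hs => ?_) (by simp)
  rcases h s hs with h0 | ⟨u, hu, hj⟩
  · simp [h0]
  · rw [dDet_zero_col n _ _ u s hu, smul_zero]
    rw [Function.update_of_ne hu, Function.update_self, hj]

/-- Let `f = p_{1,0,−1} + p_{0,0,−1}`. Then:
(i) `f(d_{ι,(0,…,n−1,n+2)}) = −(n+2)²·d_{ι,(0,…,n−1,n+1)}`;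
(ii) `f(d_{ι,(0,…,n−1,n+1)}) = −(n+1)²·d_0`;
(iii) `f(d_{ι,(0,…,n−2,n,n+1)}) = −n²·d_{ι,(0,…,n−1,n+1)}`. -/
theorem f_on_dDet (n : ℕ) (hn : 1 ≤ n) :
    (pDer 1 0 (-1) + pDer 0 0 (-1))
        (dDet n (iot n) (Function.update (iot n) (Fin.last n) (n + 2))) =
      (-((n : ℂ) + 2) ^ 2) • dDet n (iot n) (Function.update (iot n) (Fin.last n) (n + 1)) ∧
    (pDer 1 0 (-1) + pDer 0 0 (-1))
        (dDet n (iot n) (Function.update (iot n) (Fin.last n) (n + 1))) =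
      (-((n : ℂ) + 1) ^ 2) • dDet n (iot n) (iot n) ∧
    (pDer 1 0 (-1) + pDer 0 0 (-1))
        (dDet n (iot n) (fun r => if (r : ℕ) < n - 1 then (r : ℕ) else (r : ℕ) + 1)) =
      (-(n : ℂ) ^ 2) • dDet n (iot n) (Function.update (iot n) (Fin.last n) (n + 1)) := by
  have key : ∀ k : ℕ, ∀ s : Fin (n + 1), s ≠ Fin.last n →
      Function.update (iot n) (Fin.last n) k s = 0 ∨ ∃ u, u ≠ s ∧
        Function.update (iot n) (Fin.last n) k u =
          Function.update (iot n) (Fin.last n) k s - 1 := by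
    intro k s hs
    have hv : (s : ℕ) ≠ n := fun e => hs (Fin.ext (by simpa using e))
    rw [Function.update_of_ne hs]
    by_cases h : (s : ℕ) = 0
    · left; exact h
    · right
      refine ⟨⟨(s : ℕ) - 1, by omega⟩, ?_, ?_⟩
      · intro e; have := congrArg Fin.val e; simp at this; omega
      · rw [Function.update_of_ne]
        · rfl
        · intro e; have := congrArg Fin.val e; simp at this; omega
  refine ⟨?_, ?_, ?_⟩
  · rw [f_single n _ (Fin.last n) (key _)]
    simp
  · rw [f_single n _ (Fin.last n) (key _)]
    have : Function.update (iot n) (Fin.last n) n = iot n := by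
      conv_rhs => rw [← Function.update_eq_self (Fin.last n) (iot n)]
      simp [iot]
    simp [this]
  · rw [f_single n _ ⟨n - 1, by omega⟩]
    · have e : ∀ J' : Fin (n + 1) → ℕ, ∀ x : ℕ, x = n →
          J' = Function.update (iot n) (Fin.last n) (n + 1) →
          (-(x : ℂ) ^ 2) • dDet n (iot n) J' =
          (-(n : ℂ) ^ 2) • dDet n (iot n) (Function.update (iot n) (Fin.last n) (n + 1)) := by
        rintro _ _ rfl rfl; rfl
      apply e
      · simp; omega
      · funext s
        have := s.isLt
        simp only [Function.update_apply, Fin.ext_iff, Fin.val_last, iot]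
        split_ifs <;> omega
    · intro s hs
      have hv : (s : ℕ) ≠ n - 1 := fun e => hs (Fin.ext (by simpa using e))
      by_cases h : (s : ℕ) = 0
      · left; split_ifs <;> omega
      · right
        have := s.isLt
        refine ⟨⟨(s : ℕ) - 1, by omega⟩, ?_, ?_⟩
        · intro e; have := congrArg Fin.val e; simp at this; omega
        · simp only
          split_ifs <;> omega
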